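/- Let f ∈ C^∞(ℝ) be such that f' is of order at most r for some r < −1, and for each j ≥ 2 define g_j : ℝ → ℝ by g_j(x) := −x^{j−2} f'(1/x) for x ≠ 0 and g_j(0) := 0. Then for all n ≥ 2, all m ≥ 1, and all x_1, …, x_n ∈ ℝ, one has g_{n+m}[x_1, …, x_n, 0, …, 0] = g_n[x_1, …, x_n], where the left-hand side has m arguments equal to 0 appended. -/

import Mathlib

open MeasureTheory

/-- Divided difference of order `n-1` of `f` at the `n` points `x`, defined via the
integral formula over the simplex (and set to `0` for the empty tuple). -/
noncomputable def divDiff (f : ℝ → ℝ) : {n : ℕ} → (Fin n → ℝ) → ℝ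
  | 0, _ => 0
  | m + 1, x =>
    ∫ t in {t : Fin m → ℝ | Monotone t ∧ ∀ j, t j ∈ Set.Icc (0 : ℝ) 1},
      iteratedDeriv m f (x (Fin.last m) + ∑ j : Fin m, (x j.castSucc - x j.succ) * t j)

/-- `f` is of order at most `r`: for every `k` there are `R, c₂ > 0` with
`|f^(k)(x)| ≤ c₂ |x|^(r-k)` for all `|x| > R`. -/
def OrderAtMost (f : ℝ → ℝ) (r : ℝ) : Prop :=
  ∀ k : ℕ, ∃ R c₂ : ℝ, 0 < R ∧ 0 < c₂ ∧
    ∀ x : ℝ, R < |x| → |iteratedDeriv k f x| ≤ c₂ * |x| ^ (r - (k : ℝ))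

/-- The function `g_j(x) = −x^(j−2) f'(1/x)` for `x ≠ 0`, with `g_j(0) = 0`. -/
noncomputable def gfun (f : ℝ → ℝ) (j : ℕ) (x : ℝ) : ℝ :=
  if x = 0 then 0 else -x ^ (j - 2) * deriv f (1 / x)

/-- The function `x ↦ x ^ p * F^(k)(x⁻¹)`, extended by `0` at the origin. -/
noncomputable def zpowMulInvDeriv (F : ℝ → ℝ) (p : ℤ) (k : ℕ) (x : ℝ) : ℝ :=
  if x = 0 then 0 else x ^ p * iteratedDeriv k F x⁻¹

namespace zpowMulInvDeriv

open Filter Topology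

variable {F : ℝ → ℝ} {r : ℝ}

theorem apply_zero (F : ℝ → ℝ) (p : ℤ) (k : ℕ) : zpowMulInvDeriv F p k 0 = 0 := by
  simp [zpowMulInvDeriv]

theorem apply_of_ne_zero (F : ℝ → ℝ) (p : ℤ) (k : ℕ) {x : ℝ} (hx : x ≠ 0) :
    zpowMulInvDeriv F p k x = x ^ p * iteratedDeriv k F x⁻¹ := by
  simp [zpowMulInvDeriv, hx]

theorem tendsto_zero (hF : OrderAtMost F r) {p : ℤ} {k : ℕ} (h : 0 < (p : ℝ) + k - r) :
    Tendsto (zpowMulInvDeriv F p k) (𝓝 0) (𝓝 0) := by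
  obtain ⟨R, c, hR, hc, hb⟩ := hF k
  have hlim : Tendsto (fun x : ℝ => c * |x| ^ ((p : ℝ) + k - r)) (𝓝 0) (𝓝 0) := by
    have : Continuous fun x : ℝ => c * |x| ^ ((p : ℝ) + k - r) :=
      continuous_const.mul (continuous_abs.rpow_const fun _ => Or.inr h.le)
    simpa [Real.zero_rpow h.ne'] using this.tendsto 0
  refine squeeze_zero_norm' ?_ hlim
  filter_upwards [Metric.ball_mem_nhds (0 : ℝ) (inv_pos.mpr hR)] with x hx
  rw [mem_ball_zero_iff, Real.norm_eq_abs] at hx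
  rcases eq_or_ne x 0 with rfl | hx0
  · rw [apply_zero, norm_zero]
    positivity
  · have hpos : 0 < |x| := abs_pos.mpr hx0
    have hinv : R < |x⁻¹| := by
      rw [abs_inv]
      exact (lt_inv_comm₀ hR hpos).mpr hx
    rw [apply_of_ne_zero F p k hx0, norm_mul, norm_zpow, Real.norm_eq_abs, Real.norm_eq_abs]
    calc |x| ^ p * |iteratedDeriv k F x⁻¹| ≤ |x| ^ p * (c * |x⁻¹| ^ (r - (k : ℝ))) := by
          gcongr
          exact hb _ hinv
      _ = c * |x| ^ ((p : ℝ) + k - r) := by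
          rw [abs_inv, Real.inv_rpow hpos.le, ← Real.rpow_neg hpos.le, ← Real.rpow_intCast,
            mul_left_comm, ← Real.rpow_add hpos]
          ring_nf

theorem hasDerivAt (hF : ContDiff ℝ (⊤ : ℕ∞) F) (hord : OrderAtMost F r) (hr : r < -1)
    {p : ℤ} {k : ℕ} (h : 0 ≤ p + k) (x : ℝ) :
    HasDerivAt (zpowMulInvDeriv F p k)
      (p * zpowMulInvDeriv F (p - 1) k x - zpowMulInvDeriv F (p - 2) (k + 1) x) x := by
  rcases eq_or_ne x 0 with rfl | hx
  · rw [hasDerivAt_iff_tendsto_slope]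
    simp only [apply_zero, mul_zero, sub_zero]
    have hR : (0 : ℝ) ≤ p + k := by exact_mod_cast h
    refine ((tendsto_zero (p := p - 1) (k := k) hord (by push_cast; linarith)).mono_left
      nhdsWithin_le_nhds).congr' ?_
    filter_upwards [self_mem_nhdsWithin] with x hx
    have hx : x ≠ 0 := hx
    rw [slope_def_field, apply_zero, apply_of_ne_zero _ _ _ hx, apply_of_ne_zero _ _ _ hx,
      zpow_sub_one₀ hx]
    field_simp
    ring
  · have h1 : HasDerivAt (iteratedDeriv k F) (iteratedDeriv (k + 1) F x⁻¹) x⁻¹ := by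
      rw [iteratedDeriv_succ]
      exact ((hF.differentiable_iteratedDeriv k (by exact_mod_cast WithTop.coe_lt_top k)) _).hasDerivAt
    have h2 := (hasDerivAt_zpow p x (Or.inl hx)).mul (h1.comp x (hasDerivAt_inv hx))
    refine (h2.congr_of_eventuallyEq ?_).congr_deriv ?_
    · filter_upwards [isOpen_ne.mem_nhds hx] with y hy
      exact apply_of_ne_zero F p k hy
    · rw [apply_of_ne_zero _ _ _ hx, apply_of_ne_zero _ _ _ hx, zpow_sub₀ hx p 2]
      simp only [Function.comp]
      rw [zpow_ofNat]
      field_simp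
      ring

theorem contDiff_and_iteratedDeriv_zero (hF : ContDiff ℝ (⊤ : ℕ∞) F) (hord : OrderAtMost F r)
    (hr : r < -1) (q : ℕ) {p : ℤ} {k : ℕ} (h : (q : ℤ) ≤ p + k + 1) :
    ContDiff ℝ q (zpowMulInvDeriv F p k) ∧ iteratedDeriv q (zpowMulInvDeriv F p k) 0 = 0 := by
  induction q generalizing p k with
  | zero =>
    refine ⟨contDiff_zero.mpr (continuous_iff_continuousAt.mpr fun x => ?_), by
      simp [apply_zero]⟩
    rcases eq_or_ne x 0 with rfl | hx
    · have hR : (0 : ℝ) ≤ p + k + 1 := by exact_mod_cast h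
      rw [ContinuousAt, apply_zero]
      exact tendsto_zero hord (by linarith)
    · have h1 : Continuous (iteratedDeriv k F) :=
        hF.continuous_iteratedDeriv k (by exact_mod_cast le_top)
      have h2 : ContinuousAt (fun y : ℝ => y ^ p * iteratedDeriv k F y⁻¹) x :=
        (continuousAt_zpow₀ x p (Or.inl hx)).mul
          (ContinuousAt.comp h1.continuousAt (continuousAt_inv₀ hx))
      refine h2.congr ?_
      filter_upwards [isOpen_ne.mem_nhds hx] with y hy
      exact (apply_of_ne_zero F p k hy).symm
  | succ q ih =>
    push_cast at h
    have hd := hasDerivAt hF hord hr (p := p) (k := k) (by omega)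
    have hderiv : deriv (zpowMulInvDeriv F p k) = fun x =>
        p * zpowMulInvDeriv F (p - 1) k x - zpowMulInvDeriv F (p - 2) (k + 1) x :=
      funext fun x => (hd x).deriv
    obtain ⟨c1, z1⟩ := ih (p := p - 1) (k := k) (by omega)
    obtain ⟨c2, z2⟩ := ih (p := p - 2) (k := k + 1) (by push_cast; omega)
    constructor
    · push_cast
      rw [contDiff_succ_iff_deriv]
      refine ⟨fun x => (hd x).differentiableAt, by simp, ?_⟩
      rw [hderiv]
      exact (contDiff_const.mul c1).sub c2
    · rw [iteratedDeriv_succ', hderiv,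
        iteratedDeriv_fun_sub (contDiff_const.mul c1).contDiffAt c2.contDiffAt,
        iteratedDeriv_const_mul _ c1.contDiffAt, z1, z2]
      simp

end zpowMulInvDeriv

theorem gfun_eq_neg_zpowMulInvDeriv (f : ℝ → ℝ) {j : ℕ} (hj : 2 ≤ j) :
    gfun f j = fun x => -zpowMulInvDeriv (deriv f) ((j : ℤ) - 2) 0 x := by
  funext x
  rcases eq_or_ne x 0 with rfl | hx
  · simp [gfun, zpowMulInvDeriv]
  · obtain ⟨i, rfl⟩ := Nat.exists_eq_add_of_le hj
    simp [gfun, zpowMulInvDeriv, hx]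

theorem gfun_contDiff_and_iteratedDeriv_zero {f : ℝ → ℝ} (hf : ContDiff ℝ (⊤ : ℕ∞) f) {r : ℝ}
    (hr : r < -1) (hord : OrderAtMost (deriv f) r) {q j : ℕ} (hj : 2 ≤ j) (hq : q + 1 ≤ j) :
    ContDiff ℝ q (gfun f j) ∧ iteratedDeriv q (gfun f j) 0 = 0 := by
  have hF : ContDiff ℝ (⊤ : ℕ∞) (deriv f) := (contDiff_infty_iff_deriv.mp hf).2
  obtain ⟨h1, h2⟩ := zpowMulInvDeriv.contDiff_and_iteratedDeriv_zero hF hord hr q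
    (p := (j : ℤ) - 2) (k := 0) (by push_cast; omega)
  rw [gfun_eq_neg_zpowMulInvDeriv f hj]
  exact ⟨h1.neg, by rw [iteratedDeriv_fun_neg, h2, neg_zero]⟩

theorem gfun_contDiffAt {f : ℝ → ℝ} (hf : ContDiff ℝ (⊤ : ℕ∞) f) (j : ℕ) {x : ℝ} (hx : x ≠ 0) :
    ContDiffAt ℝ (⊤ : ℕ∞) (gfun f j) x := by
  have hF : ContDiff ℝ (⊤ : ℕ∞) (deriv f) := (contDiff_infty_iff_deriv.mp hf).2
  have h : ContDiffAt ℝ (⊤ : ℕ∞) (fun y : ℝ => -y ^ (j - 2) * deriv f y⁻¹) x :=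
    (contDiff_id.pow _).neg.contDiffAt.mul
      (ContDiffAt.comp x hF.contDiffAt (contDiffAt_inv ℝ hx))
  refine h.congr_of_eventuallyEq ?_
  filter_upwards [isOpen_ne.mem_nhds hx] with y hy
  have hy : y ≠ 0 := hy
  simp [gfun, hy]

theorem gfun_succ (f : ℝ → ℝ) {j : ℕ} (hj : 2 ≤ j) :
    gfun f (j + 1) = fun x => x * gfun f j x := by
  funext x
  obtain ⟨i, rfl⟩ := Nat.exists_eq_add_of_le hj
  rcases eq_or_ne x 0 with rfl | hx
  · simp [gfun]
  · rw [gfun, gfun, if_neg hx, if_neg hx, show 2 + i + 1 - 2 = i + 1 by omega,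
      Nat.add_sub_cancel_left]
    ring

theorem iteratedDeriv_succ_id_mul {h : ℝ → ℝ} {n : ℕ} {x : ℝ} (hh : ContDiffAt ℝ (n + 1 : ℕ) h x) :
    iteratedDeriv (n + 1) (fun y => y * h y) x =
      x * iteratedDeriv (n + 1) h x + (n + 1) * iteratedDeriv n h x := by
  have hz : ∀ i ∈ Finset.range n, ((n + 1).choose (i + 1 + 1) : ℝ) *
      iteratedDeriv (i + 1 + 1) (fun y : ℝ => y) x *
        iteratedDeriv (n + 1 - (i + 1 + 1)) h x = 0 := by
    intro i _
    simp [iteratedDeriv_fun_id]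
  rw [iteratedDeriv_fun_mul (f := fun y : ℝ => y) contDiffAt_id hh, Finset.sum_range_succ', Finset.sum_range_succ',
    Finset.sum_eq_zero hz]
  simp [iteratedDeriv_fun_id]
  ring

theorem integral_pow_mul_iteratedDeriv_id_mul {h : ℝ → ℝ} {n : ℕ} (hh : ContDiff ℝ n h)
    (hh' : ∀ x ≠ 0, ContDiffAt ℝ (n + 1 : ℕ) h x) (hH : ContDiff ℝ (n + 1 : ℕ) fun x => x * h x)
    (h0 : iteratedDeriv n h 0 = 0) (hH0 : iteratedDeriv (n + 1) (fun x => x * h x) 0 = 0)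
    (u : ℝ) :
    ∫ s in (0 : ℝ)..1, s ^ n * iteratedDeriv (n + 1) (fun x => x * h x) (s * u) =
      iteratedDeriv n h u := by
  rcases eq_or_ne u 0 with rfl | hu
  · simp [h0, hH0]
  have hc : Continuous (iteratedDeriv n h) := hh.continuous_iteratedDeriv n le_rfl
  have hc' : Continuous (iteratedDeriv (n + 1) fun x => x * h x) :=
    hH.continuous_iteratedDeriv (n + 1) le_rfl
  rw [intervalIntegral.integral_eq_sub_of_hasDerivAt_of_le
    (f := fun s : ℝ => s ^ (n + 1) * iteratedDeriv n h (s * u)) zero_le_one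
    (by fun_prop) _ (by apply Continuous.intervalIntegrable; fun_prop)]
  · simp
  intro s hs
  have hs0 : s ≠ 0 := hs.1.ne'
  have hsu : s * u ≠ 0 := mul_ne_zero hs0 hu
  have h1 : HasDerivAt (iteratedDeriv n h) (iteratedDeriv (n + 1) h (s * u)) (s * u) := by
    rw [iteratedDeriv_succ]
    have hd : DifferentiableAt ℝ (iteratedDeriv n h) (s * u) := by
      rw [iteratedDeriv_eq_equiv_comp, LinearIsometryEquiv.comp_differentiableAt_iff]
      exact (hh' _ hsu).differentiableAt_iteratedFDeriv (by exact_mod_cast n.lt_succ_self)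
    exact hd.hasDerivAt
  have h2 := (hasDerivAt_pow (n + 1) s).mul (h1.comp s ((hasDerivAt_id s).mul_const u))
  refine h2.congr_deriv ?_
  rw [iteratedDeriv_succ_id_mul (hh' _ hsu)]
  simp only [Function.comp, id]
  push_cast
  ring

/-- The simplex of monotone tuples in `[0, 1]`. -/
def monotoneSimplex (n : ℕ) : Set (Fin n → ℝ) :=
  {t | Monotone t ∧ ∀ j, t j ∈ Set.Icc (0 : ℝ) 1}

theorem isCompact_monotoneSimplex (n : ℕ) : IsCompact (monotoneSimplex n) := by
  have hm : IsClosed {t : Fin n → ℝ | Monotone t} := by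
    have : {t : Fin n → ℝ | Monotone t} = ⋂ (i) (j) (_ : i ≤ j), {t | t i ≤ t j} := by
      ext t
      simp [Monotone]
    rw [this]
    exact isClosed_iInter fun i => isClosed_iInter fun j => isClosed_iInter fun _ =>
      isClosed_le (continuous_apply i) (continuous_apply j)
  have hK : IsCompact (Set.univ.pi fun _ : Fin n => Set.Icc (0 : ℝ) 1) :=
    isCompact_univ_pi fun _ => isCompact_Icc
  convert hK.inter_left hm using 1
  ext t
  simp only [monotoneSimplex, Set.mem_ofPred_eq, Set.mem_inter_iff, Set.mem_univ_pi]

theorem snoc_smul_mem_monotoneSimplex_iff {n : ℕ} {s : ℝ} (hs : s ∈ Set.Ioc (0 : ℝ) 1)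
    (t : Fin n → ℝ) :
    (Fin.snoc (s • t) s : Fin (n + 1) → ℝ) ∈ monotoneSimplex (n + 1) ↔ t ∈ monotoneSimplex n := by
  constructor
  · rintro ⟨hm, hI⟩
    refine ⟨fun i j hij => ?_, fun j => ⟨?_, ?_⟩⟩
    · have := hm (Fin.castSucc_le_castSucc_iff.mpr hij)
      simp only [Fin.snoc_castSucc, Pi.smul_apply, smul_eq_mul] at this
      exact le_of_mul_le_mul_left this hs.1
    · have := (hI j.castSucc).1
      simp only [Fin.snoc_castSucc, Pi.smul_apply, smul_eq_mul] at this
      exact nonneg_of_mul_nonneg_right this hs.1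
    · have := hm (Fin.le_last j.castSucc)
      simp only [Fin.snoc_castSucc, Fin.snoc_last, Pi.smul_apply, smul_eq_mul] at this
      exact (mul_le_iff_le_one_right hs.1).mp this
  · rintro ⟨hm, hI⟩
    refine ⟨fun i j hij => ?_, fun j => ?_⟩
    · induction j using Fin.lastCases with
      | last =>
        induction i using Fin.lastCases with
        | last => rfl
        | cast i =>
          simp only [Fin.snoc_castSucc, Fin.snoc_last, Pi.smul_apply, smul_eq_mul]
          exact mul_le_of_le_one_right hs.1.le (hI i).2
      | cast j =>
        induction i using Fin.lastCases with
        | last => exact absurd hij (not_le.mpr (Fin.castSucc_lt_last j))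
        | cast i =>
          simp only [Fin.snoc_castSucc, Pi.smul_apply, smul_eq_mul]
          exact mul_le_mul_of_nonneg_left (hm (Fin.castSucc_le_castSucc_iff.mp hij)) hs.1.le
    · induction j using Fin.lastCases with
      | last => simpa only [Fin.snoc_last] using Set.Ioc_subset_Icc_self hs
      | cast j =>
        simp only [Fin.snoc_castSucc, Pi.smul_apply, smul_eq_mul]
        exact ⟨mul_nonneg hs.1.le (hI j).1, mul_le_one₀ hs.2 (hI j).1 (hI j).2⟩

theorem setIntegral_monotoneSimplex_succ {n : ℕ} {G : (Fin (n + 1) → ℝ) → ℝ} (hG : Continuous G) :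
    ∫ t in monotoneSimplex (n + 1), G t =
      ∫ s in Set.Ioc (0 : ℝ) 1, s ^ n * ∫ t in monotoneSimplex n, G (Fin.snoc (s • t) s) := by
  have hK := isCompact_monotoneSimplex (n + 1)
  have hms : MeasurableSet (monotoneSimplex (n + 1)) := hK.measurableSet
  set φ : (Fin (n + 1) → ℝ) → ℝ := (monotoneSimplex (n + 1)).indicator G with hφ
  have hint : Integrable φ := (hG.continuousOn.integrableOn_compact hK).integrable_indicator hms
  have hmp := (volume_preserving_piFinSuccAbove (fun _ : Fin (n + 1) => ℝ) (Fin.last n)).symm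
  have hsymm : ∀ z : ℝ × (Fin n → ℝ),
      (MeasurableEquiv.piFinSuccAbove (fun _ : Fin (n + 1) => ℝ) (Fin.last n)).symm z =
        (Fin.snoc z.2 z.1 : Fin (n + 1) → ℝ) := by
    intro z
    exact Fin.insertNth_last' z.1 z.2
  have hint' : Integrable (fun z => φ
      ((MeasurableEquiv.piFinSuccAbove (fun _ : Fin (n + 1) => ℝ) (Fin.last n)).symm z))
      (volume.prod volume) := hmp.integrable_comp_of_integrable hint
  rw [← integral_indicator hms, ← hmp.integral_comp' φ, Measure.volume_eq_prod,
    integral_prod _ hint', ← integral_indicator measurableSet_Ioc]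
  refine integral_congr_ae ?_
  filter_upwards [compl_mem_ae_iff.mpr (measure_singleton (0 : ℝ))] with s hs0
  have hs0 : s ≠ 0 := hs0
  simp only [hsymm]
  by_cases hs : s ∈ Set.Ioc (0 : ℝ) 1
  · rw [Set.indicator_of_mem hs, ← integral_indicator (isCompact_monotoneSimplex n).measurableSet]
    have hsc := Measure.integral_comp_smul (volume : Measure (Fin n → ℝ))
      (fun t => φ (Fin.snoc t s)) s
    have hpos : 0 < s ^ n := pow_pos hs.1 n
    rw [Module.finrank_fin_fun, abs_of_pos (inv_pos.mpr hpos), smul_eq_mul,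
      eq_inv_mul_iff_mul_eq₀ hpos.ne'] at hsc
    rw [← hsc]
    congr 2
    funext t
    by_cases ht : t ∈ monotoneSimplex n
    · rw [Set.indicator_of_mem ht, hφ,
        Set.indicator_of_mem ((snoc_smul_mem_monotoneSimplex_iff hs t).mpr ht)]
    · rw [Set.indicator_of_notMem ht, hφ,
        Set.indicator_of_notMem (mt (snoc_smul_mem_monotoneSimplex_iff hs t).mp ht)]
  · rw [Set.indicator_of_notMem hs]
    refine integral_eq_zero_of_ae (Filter.Eventually.of_forall fun t => ?_)
    refine Set.indicator_of_notMem (fun hmem => hs ?_) _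
    have := hmem.2 (Fin.last n)
    rw [Fin.snoc_last] at this
    exact ⟨lt_of_le_of_ne this.1 hs0.symm, this.2⟩

theorem divDiff_id_mul_snoc_zero {h : ℝ → ℝ} {n : ℕ} (hh : ContDiff ℝ n h)
    (hh' : ∀ x ≠ 0, ContDiffAt ℝ (n + 1 : ℕ) h x) (hH : ContDiff ℝ (n + 1 : ℕ) fun x => x * h x)
    (h0 : iteratedDeriv n h 0 = 0) (hH0 : iteratedDeriv (n + 1) (fun x => x * h x) 0 = 0)
    (x : Fin (n + 1) → ℝ) :
    divDiff (fun y => y * h y) (Fin.snoc x 0 : Fin (n + 2) → ℝ) = divDiff h x := by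
  have hc : Continuous (iteratedDeriv (n + 1) fun x => x * h x) :=
    hH.continuous_iteratedDeriv (n + 1) le_rfl
  set D := iteratedDeriv (n + 1) fun x => x * h x with hD
  let u : (Fin n → ℝ) → ℝ := fun t =>
    x (Fin.last n) + ∑ j : Fin n, (x j.castSucc - x j.succ) * t j
  have hu : Continuous u := by fun_prop
  let y : Fin (n + 2) → ℝ := Fin.snoc x 0
  have harg : ∀ (s : ℝ) (t : Fin n → ℝ),
      y (Fin.last (n + 1)) + ∑ j : Fin (n + 1), (y j.castSucc - y j.succ) *
        (Fin.snoc (s • t) s : Fin (n + 1) → ℝ) j = s * u t := by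
    intro s t
    rw [Fin.sum_univ_castSucc]
    simp only [y, u, Fin.snoc_last, Fin.snoc_castSucc, Fin.succ_last, ← Fin.castSucc_succ,
      Pi.smul_apply, smul_eq_mul, mul_add, Finset.mul_sum]
    rw [zero_add, sub_zero, add_comm, mul_comm s]
    congr 1
    exact Finset.sum_congr rfl fun j _ => by ring
  have hL : divDiff (fun y => y * h y) y = ∫ t in monotoneSimplex (n + 1),
      D (y (Fin.last (n + 1)) + ∑ j : Fin (n + 1), (y j.castSucc - y j.succ) * t j) := rfl
  have hR : divDiff h x = ∫ t in monotoneSimplex n, iteratedDeriv n h (u t) := rfl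
  have hcont : Continuous fun z : ℝ × (Fin n → ℝ) => z.1 ^ n * D (z.1 * u z.2) := by fun_prop
  have hint : Integrable (Function.uncurry fun (s : ℝ) (t : Fin n → ℝ) => s ^ n * D (s * u t))
      ((volume.restrict (Set.Ioc (0 : ℝ) 1)).prod (volume.restrict (monotoneSimplex n))) := by
    rw [Measure.prod_restrict]
    exact (hcont.continuousOn.integrableOn_compact
      (isCompact_Icc.prod (isCompact_monotoneSimplex n))).mono_set
        (Set.prod_mono Set.Ioc_subset_Icc_self subset_rfl)
  rw [hL, hR, setIntegral_monotoneSimplex_succ (by fun_prop)]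
  simp only [harg, ← integral_const_mul]
  rw [integral_integral_swap hint]
  refine integral_congr_ae (Filter.Eventually.of_forall fun t => ?_)
  simp only
  rw [← intervalIntegral.integral_of_le zero_le_one]
  exact integral_pow_mul_iteratedDeriv_id_mul hh hh' hH h0 hH0 (u t)

theorem divDiff_gfun_succ_snoc_zero {f : ℝ → ℝ} (hf : ContDiff ℝ (⊤ : ℕ∞) f) {r : ℝ} (hr : r < -1)
    (hord : OrderAtMost (deriv f) r) {n : ℕ} (hn : 2 ≤ n) (x : Fin n → ℝ) :
    divDiff (gfun f (n + 1)) (Fin.snoc x 0 : Fin (n + 1) → ℝ) = divDiff (gfun f n) x := by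
  obtain ⟨k, rfl⟩ := Nat.exists_eq_add_of_le' (one_le_two.trans hn)
  obtain ⟨hh, h0⟩ := gfun_contDiff_and_iteratedDeriv_zero hf hr hord (q := k) hn le_rfl
  obtain ⟨hH, hH0⟩ := gfun_contDiff_and_iteratedDeriv_zero hf hr hord (q := k + 1)
    (j := k + 1 + 1) (by omega) le_rfl
  rw [gfun_succ f hn] at hH hH0 ⊢
  exact divDiff_id_mul_snoc_zero hh
    (fun y hy => (gfun_contDiffAt hf _ hy).of_le (by exact_mod_cast le_top)) hH h0 hH0 x

/-- if `f'` is of order at most `r < −1`, then for all `n ≥ 2`,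
`m ≥ 1` and `x_1,…,x_n ∈ ℝ`, appending `m` zeros to the argument tuple of the divided
difference of `g_{n+m}` yields the divided difference of `g_n`:
`g_{n+m}[x_1,…,x_n,0,…,0] = g_n[x_1,…,x_n]`. -/
theorem statement19 (f : ℝ → ℝ) (hf : ContDiff ℝ (⊤ : ℕ∞) f) (r : ℝ) (hr : r < -1)
    (hord : OrderAtMost (deriv f) r) (n m : ℕ) (hn : 2 ≤ n) (hm : 1 ≤ m)
    (x : Fin n → ℝ) :
    divDiff (gfun f (n + m)) (Fin.append x fun _ : Fin m => (0 : ℝ)) =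
      divDiff (gfun f n) x := by
  clear hm
  induction m with
  | zero =>
    rw [Fin.append_right_nil x _ rfl]
    rfl
  | succ m ih =>
    have hsnoc : (fun _ : Fin (m + 1) => (0 : ℝ)) = Fin.snoc (fun _ : Fin m => (0 : ℝ)) 0 := by
      funext i
      induction i using Fin.lastCases with
      | last => rw [Fin.snoc_last]
      | cast i => rw [Fin.snoc_castSucc]
    rw [hsnoc, Fin.append_snoc, ← ih]
    exact divDiff_gfun_succ_snoc_zero hf hr hord (le_add_right hn) _
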